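/- arXiv:2104.08934 — 7 statements merged into one kernel-verified Lean document; each statement's English description precedes it below -/
import Mathlib

section
/- Let f : ℝ → ℝ be continuously differentiable on [0,2], with f(x) ≥ 0 for all x ∈ [0,2], f nondecreasing on [0,2], and the derivative f' nondecreasing on [0,2] (i.e., f is convex there). Let P ∈ [0,1) and s ∈ (0,1]. Define Φ = ∫₀¹ [ (indicator of {v ≥ P + s})·(f(v − s) + P·f'(v − s)) − (f(P + s + max(0, v − P)) + P·f'(P + s + max(0, v − P))) ]·f(v) dv. Then Φ ≤ 0. If moreover f(x) > 0 for all x ∈ (0,2], then Φ < 0. -/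
open MeasureTheory Set

theorem MonotoneOn.nonneg_of_hasDerivAt_Icc {f : ℝ → ℝ} {f' a b x : ℝ} (hab : a < b)
    (hf : MonotoneOn f (Icc a b)) (hx : x ∈ Icc a b) (h : HasDerivAt f f' x) : 0 ≤ f' := by
  rw [← h.hasDerivWithinAt.derivWithin (uniqueDiffOn_Icc hab x hx)]
  exact hf.derivWithin_nonneg

theorem intervalIntegral.integral_nonpos {F : ℝ → ℝ} {a b : ℝ} (hab : a ≤ b)
    (hF : ∀ u ∈ Icc a b, F u ≤ 0) : ∫ u in a..b, F u ≤ 0 := by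
  have h := intervalIntegral.integral_nonneg (μ := volume) hab fun u hu => neg_nonneg.2 (hF u hu)
  rwa [intervalIntegral.integral_neg, neg_nonneg] at h

/-- The key sign computation in Theorem 1: the derivative of a firm's equilibrium
first-order condition with respect to the switching cost `s` (symmetric duopoly,
equal initial shares, zero marginal costs) is nonpositive when the density `f` of
consumer valuations is nondecreasing and convex on `[0,2]`, and strictly negative
when `f` is positive on `(0,2]`. -/
theorem foc_derivative_in_switching_cost_nonpos
    (f f' : ℝ → ℝ)
    (hderiv : ∀ x ∈ Icc (0:ℝ) 2, HasDerivAt f (f' x) x)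
    (hf'cont : ContinuousOn f' (Icc (0:ℝ) 2))
    (hf_nonneg : ∀ x ∈ Icc (0:ℝ) 2, 0 ≤ f x)
    (hf_mono : MonotoneOn f (Icc (0:ℝ) 2))
    (hf'_mono : MonotoneOn f' (Icc (0:ℝ) 2))
    (P s : ℝ) (hP : P ∈ Ico (0:ℝ) 1) (hs : s ∈ Ioc (0:ℝ) 1)
    (Φ : ℝ)
    (hΦ : Φ = ∫ v in (0:ℝ)..1,
      ((if P + s ≤ v then f (v - s) + P * f' (v - s) else 0)
        - (f (P + s + max 0 (v - P)) + P * f' (P + s + max 0 (v - P)))) * f v) :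
    Φ ≤ 0 ∧ ((∀ x ∈ Ioc (0:ℝ) 2, 0 < f x) → Φ < 0) := by
  obtain ⟨hP0, hP1⟩ := hP
  obtain ⟨hs0, hs1⟩ := hs
  have hf' : ∀ x ∈ Icc (0:ℝ) 2, 0 ≤ f' x := fun x hx =>
    hf_mono.nonneg_of_hasDerivAt_Icc two_pos hx (hderiv x hx)
  have hf : ContinuousOn f (Icc (0:ℝ) 2) := fun x hx =>
    (hderiv x hx).continuousAt.continuousWithinAt
  set g : ℝ → ℝ := fun x => f x + P * f' x
  have hg_cont : ContinuousOn g (Icc (0:ℝ) 2) := hf.add (continuousOn_const.mul hf'cont)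
  have hg_mono : MonotoneOn g (Icc (0:ℝ) 2) :=
    hf_mono.add fun x hx y hy hxy => mul_le_mul_of_nonneg_left (hf'_mono hx hy hxy) hP0
  have hfg : ∀ x ∈ Icc (0:ℝ) 2, f x ≤ g x := fun x hx =>
    le_add_of_nonneg_right (mul_nonneg hP0 (hf' x hx))
  set F : ℝ → ℝ := fun v =>
    ((if P + s ≤ v then g (v - s) else 0) - g (P + s + max 0 (v - P))) * f v with hF
  replace hΦ : Φ = ∫ v in (0:ℝ)..1, F v := hΦ
  have hmem : ∀ v ∈ Icc (0:ℝ) 1, P + s + max 0 (v - P) ∈ Ioc (0:ℝ) 2 := by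
    rintro v ⟨hv0, hv1⟩
    rcases max_cases 0 (v - P) with h | h <;> constructor <;> linarith
  have hF_nonpos : ∀ v ∈ Icc (0:ℝ) 1, F v ≤ 0 := by
    intro v hv
    have hw := Ioc_subset_Icc_self (hmem v hv)
    refine mul_nonpos_of_nonpos_of_nonneg (sub_nonpos.2 ?_)
      (hf_nonneg v ⟨hv.1, by linarith [hv.2]⟩)
    split_ifs with h
    · exact hg_mono ⟨by linarith, by linarith [hv.2]⟩ hw (by linarith [le_max_right 0 (v - P)])
    · exact (hf_nonneg _ hw).trans (hfg _ hw)
  refine ⟨?_, fun hpos => ?_⟩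
  · rw [hΦ]
    exact intervalIntegral.integral_nonpos zero_le_one hF_nonpos
  have hF_int : IntegrableOn F (Icc (0:ℝ) 1) := by
    have hG : ContinuousOn (fun v => g (max v (P + s) - s) * f v) (Icc (0:ℝ) 1) := by
      refine (hg_cont.comp (by fun_prop) ?_).mul (hf.mono (Icc_subset_Icc_right one_le_two))
      rintro v ⟨hv0, hv1⟩
      rcases max_cases v (P + s) with h | h <;> constructor <;> linarith
    have hH : ContinuousOn (fun v => g (P + s + max 0 (v - P)) * f v) (Icc (0:ℝ) 1) :=
      (hg_cont.comp (by fun_prop) fun v hv => Ioc_subset_Icc_self (hmem v hv)).mul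
        (hf.mono (Icc_subset_Icc_right one_le_two))
    have hFeq : F = fun v => (Ici (P + s)).indicator (fun v => g (max v (P + s) - s) * f v) v
        - g (P + s + max 0 (v - P)) * f v := by
      funext v
      by_cases h : P + s ≤ v
      · simp [hF, h, sub_mul]
      · simp [hF, h]
    rw [hFeq]
    exact (hG.integrableOn_Icc.indicator measurableSet_Ici).sub hH.integrableOn_Icc
  set c := min 1 (P + s)
  have hc0 : 0 < c := lt_min one_pos (by linarith)
  have hc1 : c ≤ 1 := min_le_left _ _
  have hi₁ : IntervalIntegrable F volume 0 c :=
    (intervalIntegrable_iff_integrableOn_Icc_of_le hc0.le).2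
      (hF_int.mono_set (Icc_subset_Icc_right hc1))
  have hi₂ : IntervalIntegrable F volume c 1 :=
    (intervalIntegrable_iff_integrableOn_Icc_of_le hc1).2
      (hF_int.mono_set (Icc_subset_Icc_left hc0.le))
  have h₁ : 0 < ∫ v in (0:ℝ)..c, -F v := by
    refine intervalIntegral.intervalIntegral_pos_of_pos_on hi₁.neg (fun v hv => ?_) hc0
    have hvs : ¬ P + s ≤ v := not_le.2 (hv.2.trans_le (min_le_right _ _))
    have hv1 : v < 1 := hv.2.trans_le hc1
    have hw := hmem v ⟨hv.1.le, hv1.le⟩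
    have hgw := (hpos _ hw).trans_le (hfg _ (Ioc_subset_Icc_self hw))
    simpa only [hF, if_neg hvs, zero_sub, neg_mul, neg_neg] using
      mul_pos hgw (hpos v ⟨hv.1, by linarith⟩)
  have h₂ : ∫ v in c..1, F v ≤ 0 :=
    intervalIntegral.integral_nonpos hc1 fun v hv => hF_nonpos v ⟨hc0.le.trans hv.1, hv.2⟩
  rw [intervalIntegral.integral_neg] at h₁
  rw [hΦ, ← intervalIntegral.integral_add_adjacent_intervals hi₁ hi₂]
  linarith
end

section
/- Let g : ℝ → ℝ be continuous on [0,1] and map [0,1] into [0,1]. Suppose that for every x ∈ [0,1] with g(x) = x, the function g is differentiable at x with derivative strictly less than 1. Then there exists a unique x ∈ [0,1] with g(x) = x. -/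
open Filter Topology in
theorem HasDerivAt.eventually_lt_id_nhdsGT {f : ℝ → ℝ} {f' x : ℝ} (hf : HasDerivAt f f' x)
    (hx : f x = x) (hf' : f' < 1) : ∀ᶠ z in 𝓝[>] x, f z < z := by
  filter_upwards [hf.hasDerivWithinAt.limsup_slope_le' (lt_irrefl x) hf',
    self_mem_nhdsWithin] with z hz (hxz : x < z)
  rw [slope_def_field, div_lt_one (sub_pos.2 hxz), hx] at hz
  linarith

open Filter Topology in
theorem HasDerivAt.eventually_id_lt_nhdsLT {f : ℝ → ℝ} {f' x : ℝ} (hf : HasDerivAt f f' x)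
    (hx : f x = x) (hf' : f' < 1) : ∀ᶠ z in 𝓝[<] x, z < f z := by
  filter_upwards [hf.hasDerivWithinAt.limsup_slope_le' (lt_irrefl x) hf',
    self_mem_nhdsWithin] with z hz (hzx : z < x)
  rw [slope_def_field, div_lt_one_of_neg (sub_neg.2 hzx), hx] at hz
  linarith

open Filter Topology in
theorem fixed_point_le_of_slope_lt_one {f : ℝ → ℝ} {a b : ℝ}
    (hcont : ContinuousOn f (Set.Icc a b))
    (hslope : ∀ x ∈ Set.Icc a b, f x = x → DifferentiableAt ℝ f x ∧ deriv f x < 1)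
    (ha : f a = a) (hb : f b = b) : b ≤ a := by
  by_contra! hab
  obtain ⟨hda, hda'⟩ := hslope a (Set.left_mem_Icc.2 hab.le) ha
  obtain ⟨c, hc, hac, hcb⟩ :=
    ((hda.hasDerivAt.eventually_lt_id_nhdsGT ha hda').and (Ioo_mem_nhdsGT hab)).exists
  have hcont' : ContinuousOn f (Set.Icc c b) := hcont.mono (Set.Icc_subset_Icc_left hac.le)
  have hclosed : IsClosed ({x | x ≤ f x} ∩ Set.Icc c b) := by
    rw [Set.inter_comm]
    exact isClosed_Icc.isClosed_le continuousOn_id hcont'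
  refine hc.not_ge (hclosed.mem_of_ge_of_forall_exists_lt hb.ge hcb.le ?_)
  rintro x ⟨hx : x ≤ f x, hcx, hxb⟩
  have hleft : ∀ᶠ z in 𝓝[<] x, z < f z := by
    rcases hx.eq_or_lt with hx | hx
    · obtain ⟨hd, hd'⟩ := hslope x ⟨(hac.trans hcx).le, hxb⟩ hx.symm
      exact hd.hasDerivAt.eventually_id_lt_nhdsLT hx.symm hd'
    · have hfx : Tendsto f (𝓝[<] x) (𝓝 (f x)) :=
        (hcont' x ⟨hcx.le, hxb⟩).mono_left <| nhdsWithin_le_of_mem <|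
          mem_of_superset (Ioo_mem_nhdsLT hcx) fun z hz => ⟨hz.1.le, hz.2.le.trans hxb⟩
      exact (tendsto_nhdsWithin_of_tendsto_nhds tendsto_id).eventually_lt hfx hx
  obtain ⟨z, hz, hcz, hzx⟩ := (hleft.and (Ioo_mem_nhdsLT hcx)).exists
  exact ⟨z, hz.le, hcz.le, hzx⟩

open Set

/-- The fixed-point principle underlying Lemma 3 (uniqueness of equilibrium):
if the best-response map `g` is continuous on `[0,1]`, maps `[0,1]` into `[0,1]`,
and at every fixed point is differentiable with slope strictly below 1,
then it has exactly one fixed point in `[0,1]`. -/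
theorem unique_fixed_point_of_slope_lt_one
    (g : ℝ → ℝ)
    (hcont : ContinuousOn g (Icc (0:ℝ) 1))
    (hmaps : MapsTo g (Icc (0:ℝ) 1) (Icc (0:ℝ) 1))
    (hslope : ∀ x ∈ Icc (0:ℝ) 1, g x = x →
      DifferentiableAt ℝ g x ∧ deriv g x < 1) :
    ∃! x, x ∈ Icc (0:ℝ) 1 ∧ g x = x := by
  have hle : ∀ x ∈ Icc (0:ℝ) 1, ∀ y ∈ Icc (0:ℝ) 1, g x = x → g y = y → y ≤ x :=
    fun x hx y hy hgx hgy => fixed_point_le_of_slope_lt_one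
      (hcont.mono (Icc_subset_Icc hx.1 hy.2))
      (fun z hz => hslope z (Icc_subset_Icc hx.1 hy.2 hz)) hgx hgy
  obtain ⟨x, hx, hgx⟩ := exists_mem_Icc_isFixedPt_of_mapsTo hcont zero_le_one hmaps
  exact ⟨x, ⟨hx, hgx⟩, fun y ⟨hy, hgy⟩ =>
    le_antisymm (hle x hx y hy hgx hgy) (hle y hy x hx hgy hgx)⟩
end

section
/- Let c ≤ P, s ∈ (0,1], Q ∈ [0,1], and μ₁, μ₂ ≥ 0. Let f : ℝ → ℝ be continuously differentiable on [P, P+2] with f(x) ≥ 0 and 2·f(x) + (P − c)·f'(x) ≥ 0 for all x ∈ [P, P+2], and let g : ℝ → ℝ be nonnegative and integrable on [0,1]. Then ∫₀¹ [ (indicator of {v ≥ Q + s})·μ₁·(f(P + v − Q − s) + (P − c)·f'(P + v − Q − s)) + (indicator of {v ≥ Q})·μ₂·(f(P + v − Q + s) + (P − c)·f'(P + v − Q + s)) − μ₁·(2·f(P + max(0, v − Q − s)) + (P − c)·f'(P + max(0, v − Q − s))) − μ₂·(2·f(P + s + max(0, v − Q)) + (P − c)·f'(P + s + max(0, v − Q)))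 ]·g(v) dv ≤ 0. -/
open MeasureTheory Set

/-- The positive cross-partial term, active for `0 ≤ t`, is dominated by the
corresponding own second derivative term. -/
lemma indicator_term_le_soc_term {f f' : ℝ → ℝ} {a t d μ : ℝ} (hμ : 0 ≤ μ)
    (hf : 0 ≤ f (a + max 0 t)) (hsoc : 0 ≤ 2 * f (a + max 0 t) + d * f' (a + max 0 t)) :
    (if 0 ≤ t then μ * (f (a + t) + d * f' (a + t)) else 0)
      ≤ μ * (2 * f (a + max 0 t) + d * f' (a + max 0 t)) := by
  split_ifs with ht
  · rw [max_eq_right ht] at hf ⊢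
    gcongr
    linarith
  · positivity

/-- The core inequality in the proof of Lemma 3 (uniqueness of the duopoly
equilibrium): the sum of the cross-partial derivative `∂²π/∂P∂Q` and the own
second derivative `∂²π/∂P²` of firm `i`'s profit is nonpositive, so the slope
of the best response is below 1. -/
theorem cross_partial_plus_own_second_nonpos
    (c P Q s μ₁ μ₂ : ℝ) (f f' g : ℝ → ℝ)
    (hcP : c ≤ P) (hs : s ∈ Ioc (0:ℝ) 1) (hQ : Q ∈ Icc (0:ℝ) 1)
    (hμ₁ : 0 ≤ μ₁) (hμ₂ : 0 ≤ μ₂)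
    (hderiv : ∀ x ∈ Icc P (P + 2), HasDerivAt f (f' x) x)
    (hf'cont : ContinuousOn f' (Icc P (P + 2)))
    (hf_nonneg : ∀ x ∈ Icc P (P + 2), 0 ≤ f x)
    (hsoc : ∀ x ∈ Icc P (P + 2), 0 ≤ 2 * f x + (P - c) * f' x)
    (hg_nonneg : ∀ v ∈ Icc (0:ℝ) 1, 0 ≤ g v)
    (hg_int : IntegrableOn g (Icc (0:ℝ) 1)) :
    (∫ v in (0:ℝ)..1,
      ((if Q + s ≤ v then μ₁ * (f (P + v - Q - s) + (P - c) * f' (P + v - Q - s)) else 0)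
        + (if Q ≤ v then μ₂ * (f (P + v - Q + s) + (P - c) * f' (P + v - Q + s)) else 0)
        - μ₁ * (2 * f (P + max 0 (v - Q - s)) + (P - c) * f' (P + max 0 (v - Q - s)))
        - μ₂ * (2 * f (P + s + max 0 (v - Q)) + (P - c) * f' (P + s + max 0 (v - Q))))
      * g v) ≤ 0 := by
  obtain ⟨hs0, hs1⟩ := hs
  obtain ⟨hQ0, -⟩ := hQ
  rw [intervalIntegral.integral_of_le zero_le_one]
  refine setIntegral_nonpos measurableSet_Ioc fun v hv => ?_
  replace hv := Ioc_subset_Icc_self hv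
  refine mul_nonpos_of_nonpos_of_nonneg ?_ (hg_nonneg v hv)
  obtain ⟨-, hv1⟩ := hv
  have mem₁ : P + max 0 (v - Q - s) ∈ Icc P (P + 2) := by
    have hmax : max 0 (v - Q - s) ≤ 2 := max_le (by norm_num) (by linarith)
    exact ⟨by linarith [le_max_left 0 (v - Q - s)], by linarith⟩
  have mem₂ : P + s + max 0 (v - Q) ∈ Icc P (P + 2) := by
    have hmax : max 0 (v - Q) ≤ 1 := max_le zero_le_one (by linarith)
    exact ⟨by linarith [le_max_left 0 (v - Q)], by linarith⟩
  have le₁ := indicator_term_le_soc_term hμ₁ (hf_nonneg _ mem₁) (hsoc _ mem₁)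
  have le₂ := indicator_term_le_soc_term hμ₂ (hf_nonneg _ mem₂) (hsoc _ mem₂)
  have cond₁ : 0 ≤ v - Q - s ↔ Q + s ≤ v := by constructor <;> intro h <;> linarith
  rw [show P + (v - Q - s) = P + v - Q - s by ring] at le₁
  rw [show P + s + (v - Q) = P + v - Q + s by ring] at le₂
  simp only [cond₁] at le₁
  simp only [sub_nonneg] at le₂
  linarith
end

section
/- Let f : ℝ → ℝ be continuously differentiable and define F(x) = ∫₀ˣ f(t) dt. Let c ∈ ℝ, s ≥ 0, v ∈ ℝ, and c ≤ P₁ ≤ P₂. Suppose f(x) + (P − c)·f'(x) ≥ 0 for all P ∈ [P₁, P₂] and all x ∈ ℝ. Define π(P, Q) = (P − c)·(1 − F(P + s + max(0, v − Q))). Then π has increasing differences in (P, Q): for all Q₁ ≤ Q₂, π(P₂, Q₂) − π(P₁, Q₂) ≥ π(P₂, Q₁) − π(P₁, Q₁). -/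
open Set intervalIntegral

/-- If `f x + (P - c) * f' x ≥ 0` for all `P ∈ [P₁, P₂]`, then `P ↦ (P - c) * f (P + a)` is
monotone on `[P₁, P₂]`. -/
theorem monotoneOn_sub_mul_comp_add {f : ℝ → ℝ} (hf : Differentiable ℝ f) {c P₁ P₂ : ℝ}
    (hcond : ∀ P ∈ Icc P₁ P₂, ∀ x, 0 ≤ f x + (P - c) * deriv f x) (a : ℝ) :
    MonotoneOn (fun P => (P - c) * f (P + a)) (Icc P₁ P₂) := by
  have hderiv : ∀ P, HasDerivAt (fun P => (P - c) * f (P + a))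
      (f (P + a) + (P - c) * deriv f (P + a)) P := fun P => by
    have h := ((hasDerivAt_id' P).sub_const c).mul ((hf (P + a)).hasDerivAt.comp_add_const P a)
    rwa [one_mul] at h
  refine monotoneOn_of_deriv_nonneg (convex_Icc P₁ P₂)
    (fun P _ => (hderiv P).continuousAt.continuousWithinAt)
    (fun P _ => (hderiv P).differentiableAt.differentiableWithinAt) fun P hP => ?_
  rw [(hderiv P).deriv]
  exact hcond P (interior_subset hP) _

/-- The gain from raising the price from `P₁` to `P₂` decreases in the shift `m` of the
demand threshold. -/
theorem antitone_profit_difference {f F : ℝ → ℝ} (hf : Differentiable ℝ f)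
    (hF : ∀ x, HasDerivAt F (f x) x) {c P₁ P₂ : ℝ} (hP : P₁ ≤ P₂)
    (hcond : ∀ P ∈ Icc P₁ P₂, ∀ x, 0 ≤ f x + (P - c) * deriv f x) (s : ℝ) :
    Antitone (fun m => (P₂ - c) * (1 - F (P₂ + s + m)) - (P₁ - c) * (1 - F (P₁ + s + m))) := by
  have hderiv : ∀ P m, HasDerivAt (fun m => (P - c) * (1 - F (P + s + m)))
      ((P - c) * -f (P + s + m)) m := fun P m =>
    (((hF (P + s + m)).comp_const_add (P + s) m).const_sub 1).const_mul (P - c)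
  refine antitone_of_hasDerivAt_nonpos (fun m => (hderiv P₂ m).sub (hderiv P₁ m)) fun m => ?_
  have hmono := monotoneOn_sub_mul_comp_add hf hcond (s + m)
    (left_mem_Icc.2 hP) (right_mem_Icc.2 hP) hP
  simp only [← add_assoc] at hmono
  simp only [Pi.zero_apply]
  linarith

/-- The supermodularity computation in Lemma 2 (strategic complementarity of prices):
firm `i`'s profit `π (P, Q) = (P − c)·(1 − F (P + s + max 0 (v − Q)))` from a consumer
initially at the rival has increasing differences in the two prices `(P, Q)` when
`f (x) + (P − c)·f' (x) ≥ 0`. -/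
theorem profit_increasing_differences_in_prices
    (f : ℝ → ℝ) (hf : ContDiff ℝ 1 f)
    (F : ℝ → ℝ) (hF : ∀ x, F x = ∫ t in (0:ℝ)..x, f t)
    (c s v P₁ P₂ : ℝ) (hs : 0 ≤ s) (hP₁ : c ≤ P₁) (hP₁₂ : P₁ ≤ P₂)
    (hcond : ∀ P ∈ Icc P₁ P₂, ∀ x, 0 ≤ f x + (P - c) * deriv f x)
    (π : ℝ → ℝ → ℝ)
    (hπ : ∀ P Q, π P Q = (P - c) * (1 - F (P + s + max 0 (v - Q)))) :
    ∀ Q₁ Q₂, Q₁ ≤ Q₂ →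
      π P₂ Q₁ - π P₁ Q₁ ≤ π P₂ Q₂ - π P₁ Q₂ := by
  intro Q₁ Q₂ hQ
  have hderiv : ∀ x, HasDerivAt F (f x) x := fun x => by
    rw [funext hF]
    exact hf.continuous.integral_hasStrictDerivAt 0 x |>.hasDerivAt
  simp only [hπ]
  exact antitone_profit_difference (hf.differentiable one_ne_zero) hderiv hP₁₂ hcond s
    (max_le_max le_rfl (sub_le_sub_left hQ v))
end

section
/- Let n ≥ 1 and let b : (Fin n → ℝ) → ℝ be monotone with respect to the pointwise order and invariant under permutations of coordinates (b(q ∘ σ) = b(q) for every permutation σ of Fin n). Let p : Fin (n+1) → ℝ satisfy p(i) = b(removal of the i-th coordinate of p) for every i ∈ Fin (n+1). Then p is constant: p(i) = p(j) for all i, j. -/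
/-- Removing `j` agrees with removing `i` and then exchanging `i` and `j`, up to reindexing. -/
theorem Fin.exists_perm_succAbove_eq_swap {n : ℕ} (i j : Fin (n + 1)) :
    ∃ σ : Equiv.Perm (Fin n), ∀ k, j.succAbove (σ k) = Equiv.swap i j (i.succAbove k) := by
  have h (x : Fin (n + 1)) : x ≠ i ↔ Equiv.swap i j x ≠ j := by
    rw [Ne, Ne, Equiv.swap_apply_eq_iff, Equiv.swap_apply_right]
  refine ⟨(finSuccAboveEquiv i).trans
    (((Equiv.swap i j).subtypeEquiv h).trans (finSuccAboveEquiv j).symm), fun k => ?_⟩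
  exact congrArg Subtype.val ((finSuccAboveEquiv j).apply_symm_apply
    ((Equiv.swap i j).subtypeEquiv h (finSuccAboveEquiv i k)))

/-- If `b` is monotone and symmetric, removing the larger of two coordinates gives the
smaller value. -/
theorem Monotone.apply_succAbove_le_of_symmetric {α β : Type*} [Preorder α] [Preorder β] {n : ℕ}
    {b : (Fin n → α) → β} (hmono : Monotone b)
    (hsymm : ∀ (σ : Equiv.Perm (Fin n)) (q : Fin n → α), b (q ∘ σ) = b q)
    {p : Fin (n + 1) → α} {i j : Fin (n + 1)} (hij : p i ≤ p j) :
    b (fun k => p (j.succAbove k)) ≤ b (fun k => p (i.succAbove k)) := by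
  obtain ⟨σ, hσ⟩ := Fin.exists_perm_succAbove_eq_swap i j
  rw [← hsymm σ]
  refine hmono fun k => ?_
  simp only [Function.comp_apply, hσ]
  by_cases hk : i.succAbove k = j
  · rwa [hk, Equiv.swap_apply_right]
  · rw [Equiv.swap_apply_of_ne_of_ne (i.succAbove_ne k) hk]

/-- The symmetry claim of Lemma 2: in a symmetric game of `n+1` firms where each
firm's best-response price `b` depends only on the unordered profile of rivals'
prices and is nondecreasing in each rival's price (strategic complements), every
price vector in which each firm's price is a best response to the others' prices
must be symmetric. -/
theorem symmetric_equilibrium_of_strategic_complements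
    (n : ℕ) (hn : 1 ≤ n) (b : (Fin n → ℝ) → ℝ)
    (hmono : Monotone b)
    (hsymm : ∀ (σ : Equiv.Perm (Fin n)) (q : Fin n → ℝ), b (q ∘ σ) = b q)
    (p : Fin (n + 1) → ℝ)
    (heq : ∀ i : Fin (n + 1), p i = b (fun j => p (i.succAbove j))) :
    ∀ i j : Fin (n + 1), p i = p j := by
  have key {i j : Fin (n + 1)} (hij : p i ≤ p j) : p i = p j := by
    refine le_antisymm hij ?_
    rw [heq i, heq j]
    exact hmono.apply_succAbove_le_of_symmetric hsymm hij
  intro i j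
  exact (le_total (p i) (p j)).elim key fun h => (key h).symm
end

section
/- Let f : ℝ → ℝ be continuously differentiable with f ≥ 0, define F(x) = ∫₀ˣ f(t) dt, and let c ∈ ℝ. Suppose f(x) + (P − c)·f'(x) ≥ 0 for all P ≥ c and all x ∈ ℝ. Let μ be a finite measure on a measurable space V, let a, b : V → ℝ be measurable with a(v) ≤ b(v) for μ-almost every v, and assume all relevant integrals exist. For λ ∈ [0,1] define π_λ(P) = (P − c)·∫ [ λ·(1 − F(P + a(v))) + (1 − λ)·(1 − F(P + b(v))) ] dμ(v). Then for all c ≤ P₁ ≤ P₂ and all 0 ≤ λ₂ ≤ λ₁ ≤ 1: π_{λ₂}(P₂) − π_{λ₂}(P₁) ≤ π_{λ₁}(P₂) − π_{λ₁}(P₁). -/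
open MeasureTheory Set

/-- If `f + k * f'` is nonnegative for a primitive `F` of `f`, then `F + k * f` is monotone. -/
theorem monotone_primitive_add_const_mul {F f : ℝ → ℝ} (hF : ∀ x, HasDerivAt F (f x) x)
    (hf : Differentiable ℝ f) {k : ℝ} (hk : ∀ x, 0 ≤ f x + k * deriv f x) :
    Monotone (fun x => F x + k * f x) :=
  monotone_of_hasDerivAt_nonneg
    (fun x => (hF x).add ((hf x).hasDerivAt.const_mul k)) hk

/-- The profit lost on valuations between the thresholds `P + a` and `P + b` grows with the
price `P`. -/
theorem monotoneOn_markup_mul_increment {F f : ℝ → ℝ} (hF : ∀ x, HasDerivAt F (f x) x)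
    (hf : Differentiable ℝ f) {c : ℝ}
    (hcond : ∀ P, c ≤ P → ∀ x, 0 ≤ f x + (P - c) * deriv f x) {a b : ℝ} (hab : a ≤ b) :
    MonotoneOn (fun P => (P - c) * (F (P + b) - F (P + a))) (Ici c) := by
  have hderiv : ∀ P, HasDerivAt (fun P => (P - c) * (F (P + b) - F (P + a)))
      (1 * (F (P + b) - F (P + a)) + (P - c) * (f (P + b) - f (P + a))) P := fun P =>
    ((hasDerivAt_id P).sub_const c).mul
      (((hF (P + b)).comp_add_const P b).sub ((hF (P + a)).comp_add_const P a))
  refine monotoneOn_of_deriv_nonneg (convex_Ici c)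
    (fun P _ => (hderiv P).continuousAt.continuousWithinAt)
    (fun P _ => (hderiv P).differentiableAt.differentiableWithinAt) fun P hP => ?_
  have hmono := monotone_primitive_add_const_mul hF hf (hcond P (interior_subset hP))
    (add_le_add_right hab P)
  rw [(hderiv P).deriv]
  dsimp only at hmono
  linarith

/-- Lemma 2's claim that equilibrium prices decrease in the number of firms:
marginal profit decreases as weight shifts from the own-customer demand term
(threshold `P + a v`) to the switcher demand term (higher threshold `P + b v`),
so the maximizing price decreases with more weight on switchers. -/
theorem marginal_profit_decreases_in_switcher_weight
    {V : Type*} [MeasurableSpace V] (μ : Measure V) [IsFiniteMeasure μ]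
    (f : ℝ → ℝ) (hf : ContDiff ℝ 1 f) (hf_nonneg : ∀ x, 0 ≤ f x)
    (F : ℝ → ℝ) (hF : ∀ x, F x = ∫ t in (0:ℝ)..x, f t)
    (c : ℝ)
    (hcond : ∀ P, c ≤ P → ∀ x, 0 ≤ f x + (P - c) * deriv f x)
    (a b : V → ℝ) (ha : Measurable a) (hb : Measurable b)
    (hab : ∀ᵐ v ∂μ, a v ≤ b v)
    (hainteg : ∀ P : ℝ, Integrable (fun v => 1 - F (P + a v)) μ)
    (hbinteg : ∀ P : ℝ, Integrable (fun v => 1 - F (P + b v)) μ)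
    (π : ℝ → ℝ → ℝ)
    (hπ : ∀ lam P, π lam P =
      (P - c) * ∫ v, (lam * (1 - F (P + a v)) + (1 - lam) * (1 - F (P + b v))) ∂μ) :
    ∀ P₁ P₂ lam₁ lam₂, c ≤ P₁ → P₁ ≤ P₂ → 0 ≤ lam₂ → lam₂ ≤ lam₁ → lam₁ ≤ 1 →
      π lam₂ P₂ - π lam₂ P₁ ≤ π lam₁ P₂ - π lam₁ P₁ := by
  intro P₁ P₂ lam₁ lam₂ hc hP _ hlam _
  have hF' : ∀ x, HasDerivAt F (f x) x := by
    rw [funext hF]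
    exact fun x => hf.continuous.integral_hasStrictDerivAt 0 x |>.hasDerivAt
  have hprofit : ∀ lam P, π lam P =
      (P - c) * (lam * ∫ v, (1 - F (P + a v)) ∂μ + (1 - lam) * ∫ v, (1 - F (P + b v)) ∂μ) := by
    intro lam P
    rw [hπ, integral_add ((hainteg P).const_mul _) ((hbinteg P).const_mul _),
      integral_const_mul, integral_const_mul]
  have hint : ∀ P, Integrable
      (fun v => (P - c) * ((1 - F (P + a v)) - (1 - F (P + b v)))) μ :=
    fun P => ((hainteg P).sub (hbinteg P)).const_mul _
  have hslope : (P₁ - c) * (∫ v, (1 - F (P₁ + a v)) ∂μ - ∫ v, (1 - F (P₁ + b v)) ∂μ) ≤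
      (P₂ - c) * (∫ v, (1 - F (P₂ + a v)) ∂μ - ∫ v, (1 - F (P₂ + b v)) ∂μ) := by
    rw [← integral_sub (hainteg P₁) (hbinteg P₁), ← integral_sub (hainteg P₂) (hbinteg P₂),
      ← integral_const_mul, ← integral_const_mul]
    refine integral_mono_ae (hint P₁) (hint P₂) ?_
    filter_upwards [hab] with v hv
    have hmono := monotoneOn_markup_mul_increment hF' (hf.differentiable one_ne_zero) hcond hv
      (mem_Ici.2 hc) (mem_Ici.2 (hc.trans hP)) hP
    dsimp only at hmono
    linarith
  simp only [hprofit]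
  linarith [mul_le_mul_of_nonneg_left hslope (sub_nonneg.2 hlam)]
end

section
/- Let f : ℝ → ℝ be nonnegative, nondecreasing, and locally integrable, define F(x) = ∫₀ˣ f(t) dt, and let c ∈ ℝ. Define π(P, a) = (P − c)·(1 − F(P + a)). Then π has decreasing differences in (P, a): for all c ≤ P₁ ≤ P₂ and all a₁ ≤ a₂, π(P₂, a₂) − π(P₁, a₂) ≤ π(P₂, a₁) − π(P₁, a₁). -/
open MeasureTheory

/-- The price-discrimination claim in Section 3: with a nonnegative nondecreasing
valuation density `f` (cdf `F`), the segment profit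
`π (P, a) = (P − c)·(1 − F (P + a))` has decreasing differences in `(P, a)`,
so the profit-maximizing price is lower for the segment with the larger
threshold shift `a` (the incoming switchers). -/
theorem profit_decreasing_differences_in_markup
    (f : ℝ → ℝ) (hf_nonneg : ∀ x, 0 ≤ f x) (hf_mono : Monotone f)
    (hf_loc : LocallyIntegrable f volume)
    (F : ℝ → ℝ) (hF : ∀ x, F x = ∫ t in (0:ℝ)..x, f t)
    (c : ℝ) (π : ℝ → ℝ → ℝ)
    (hπ : ∀ P a, π P a = (P - c) * (1 - F (P + a))) :
    ∀ P₁ P₂ a₁ a₂, c ≤ P₁ → P₁ ≤ P₂ → a₁ ≤ a₂ →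
      π P₂ a₂ - π P₁ a₂ ≤ π P₂ a₁ - π P₁ a₁ := by
  have hint (a b : ℝ) : IntervalIntegrable f volume a b := hf_mono.intervalIntegrable
  intro P₁ P₂ a₁ a₂ hc hP ha
  have increment (P : ℝ) : F (P + a₂) - F (P + a₁) = ∫ t in a₁..a₂, f (P + t) := by
    rw [hF, hF, intervalIntegral.integral_interval_sub_left (hint _ _) (hint _ _),
      intervalIntegral.integral_comp_add_left]
  have hshift (P : ℝ) : IntervalIntegrable (fun t => f (P + t)) volume a₁ a₂ :=
    (hf_mono.comp fun _ _ h => add_le_add_right h P).intervalIntegrable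
  have increment_nonneg : 0 ≤ F (P₁ + a₂) - F (P₁ + a₁) := by
    rw [increment]
    exact intervalIntegral.integral_nonneg ha fun t _ => hf_nonneg _
  have increment_mono : F (P₁ + a₂) - F (P₁ + a₁) ≤ F (P₂ + a₂) - F (P₂ + a₁) := by
    rw [increment, increment]
    exact intervalIntegral.integral_mono_on ha (hshift _) (hshift _)
      fun t _ => hf_mono (by linarith)
  have := mul_le_mul (sub_le_sub_right hP c) increment_mono increment_nonneg (by linarith)
  simp only [hπ]
  linarith
end
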